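/- For every unit vector φ ∈ C² ⊗ C², the entropic entanglement parameter of the pure state |φ⟩⟨φ| is bounded below by the entropy of entanglement: M(|φ⟩⟨φ|) ≥ S_R(φ), where S_R(φ) is the von Neumann entropy of the reduced density matrix Tr_B |φ⟩⟨φ|. -/

import Mathlib

open Matrix Kronecker BigOperators ComplexOrder

noncomputable section

namespace EEP

/-- `-(x * log₂ x)`; note `Real.logb 2 0 = 0`, giving the convention `0·log₂ 0 = 0`. -/
def negMulLog2 (x : ℝ) : ℝ := -(x * Real.logb 2 x)

/-- Shannon entropy (base 2) of a finite family of reals. -/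
def shannon {n : Type*} [Fintype n] (p : n → ℝ) : ℝ := ∑ i, negMulLog2 (p i)

/-- A quantum state: positive semidefinite (hence Hermitian) matrix with trace 1. -/
def IsState {n : Type*} [Fintype n] [DecidableEq n] (ρ : Matrix n n ℂ) : Prop :=
  ρ.PosSemidef ∧ ρ.trace = 1

/-- A rank-one orthogonal projection matrix. -/
def IsRankOneProj {n : Type*} [Fintype n] [DecidableEq n] (P : Matrix n n ℂ) : Prop :=
  P.IsHermitian ∧ P * P = P ∧ P.rank = 1

/-- A von Neumann measurement on `C^d ⊗ C^d`: a family of `d²` rank-one orthogonal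
projections, mutually orthogonal, summing to the identity. -/
def IsMeasurement {d : ℕ} (P : Fin (d^2) → Matrix (Fin d × Fin d) (Fin d × Fin d) ℂ) : Prop :=
  (∀ i, IsRankOneProj (P i)) ∧ (∀ i j, i ≠ j → P i * P j = 0) ∧ (∑ i, P i) = 1

/-- Klein entropy: Shannon entropy of the outcome distribution `pᵢ = Tr(ρ Pᵢ)`. -/
def kleinEntropy {d : ℕ} (ρ : Matrix (Fin d × Fin d) (Fin d × Fin d) ℂ)
    (P : Fin (d^2) → Matrix (Fin d × Fin d) (Fin d × Fin d) ℂ) : ℝ :=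
  shannon (fun i => (ρ * P i).trace.re)

/-- A product state: Kronecker product of two states on `C^d`. -/
def IsProductState {d : ℕ} (δ : Matrix (Fin d × Fin d) (Fin d × Fin d) ℂ) : Prop :=
  ∃ σA σB : Matrix (Fin d) (Fin d) ℂ, IsState σA ∧ IsState σB ∧ δ = σA ⊗ₖ σB

/-- Infimum of the Klein entropy over product states, for a fixed measurement. -/
def infProd {d : ℕ} (P : Fin (d^2) → Matrix (Fin d × Fin d) (Fin d × Fin d) ℂ) : ℝ :=
  sInf {x : ℝ | ∃ δ, IsProductState δ ∧ x = kleinEntropy δ P}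

/-- The entropic entanglement parameter
`M(ρ) = sup_P ( inf_{δ product} H(δ,P) − H(ρ,P) )`. -/
def eep {d : ℕ} (ρ : Matrix (Fin d × Fin d) (Fin d × Fin d) ℂ) : ℝ :=
  sSup {x : ℝ | ∃ P, IsMeasurement P ∧ x = infProd P - kleinEntropy ρ P}

/-- A separable state: finite convex combination of product states. -/
def IsSeparable {d : ℕ} (ρ : Matrix (Fin d × Fin d) (Fin d × Fin d) ℂ) : Prop :=
  ∃ (m : ℕ) (p : Fin m → ℝ) (δ : Fin m → Matrix (Fin d × Fin d) (Fin d × Fin d) ℂ),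
    (∀ i, 0 ≤ p i) ∧ (∑ i, p i) = 1 ∧ (∀ i, IsProductState (δ i)) ∧
    ρ = ∑ i, (p i : ℂ) • δ i

/-- Rank-one projection `|v⟩⟨v|` onto a vector `v`. -/
def projVec {n : Type*} (v : n → ℂ) : Matrix n n ℂ := Matrix.vecMulVec v (star v)

/-- Coefficient matrix `A` of a vector `ψ ∈ C^d ⊗ C^d`, `A i j = ψ (i,j)`. -/
def coeffMat {d : ℕ} (ψ : Fin d × Fin d → ℂ) : Matrix (Fin d) (Fin d) ℂ :=
  Matrix.of fun i j => ψ (i, j)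

/-- The squared Schmidt coefficients of `ψ`: the eigenvalues of `A Aᴴ`
where `A` is the coefficient matrix of `ψ`. -/
def schmidtSq {d : ℕ} (ψ : Fin d × Fin d → ℂ) : Fin d → ℝ :=
  (Matrix.isHermitian_mul_conjTranspose_self (coeffMat ψ)).eigenvalues

/-- Largest squared Schmidt coefficient (square of the largest singular value of `A`). -/
def maxSchmidtSq {d : ℕ} (ψ : Fin d × Fin d → ℂ) : ℝ := ⨆ i, schmidtSq ψ i

/-- A unit vector. -/
def IsUnitVec {n : Type*} [Fintype n] (ψ : n → ℂ) : Prop := (∑ p, Complex.normSq (ψ p)) = 1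

/-- A maximally entangled unit vector: all squared Schmidt coefficients equal `1/d`. -/
def IsMaxEntVec {d : ℕ} (ψ : Fin d × Fin d → ℂ) : Prop :=
  IsUnitVec ψ ∧ ∀ i, schmidtSq ψ i = 1 / d

/-- A von Neumann measurement in a maximally entangled basis. -/
def IsMaxEntMeasurement {d : ℕ}
    (P : Fin (d^2) → Matrix (Fin d × Fin d) (Fin d × Fin d) ℂ) : Prop :=
  IsMeasurement P ∧ ∀ i, ∃ ψ, IsMaxEntVec ψ ∧ P i = projVec ψ

/-- Von Neumann entropy: Shannon entropy of the eigenvalues. -/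
def vnEntropy {n : Type*} [Fintype n] [DecidableEq n] {ρ : Matrix n n ℂ}
    (h : ρ.IsHermitian) : ℝ := shannon h.eigenvalues

/-- Binary Shannon entropy. -/
def binEnt (x : ℝ) : ℝ := negMulLog2 x + negMulLog2 (1 - x)

lemma negMulLog2_eq (x : ℝ) : negMulLog2 x = Real.negMulLog x / Real.log 2 := by
  unfold negMulLog2 Real.negMulLog Real.logb; ring

lemma nml_subadd {x y : ℝ} (hx : 0 ≤ x) (hy : 0 ≤ y) :
    Real.negMulLog (x + y) ≤ Real.negMulLog x + Real.negMulLog y := by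
  rcases hx.eq_or_lt with rfl | hx'
  · simp
  rcases hy.eq_or_lt with rfl | hy'
  · simp
  unfold Real.negMulLog
  have h1 := Real.log_le_log hx' (by linarith : x ≤ x + y)
  have h2 := Real.log_le_log hy' (by linarith : y ≤ x + y)
  nlinarith [mul_le_mul_of_nonneg_left h1 hx, mul_le_mul_of_nonneg_left h2 hy]

lemma ent_aux {L a b c d : ℝ} (hb : 0 ≤ b) (hc : 0 ≤ c) (hd : 0 ≤ d)
    (hs : a + b + c + d = 1) (ha : 2⁻¹ ≤ a) (haL : a ≤ L) (hL : L ≤ 1) :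
    Real.binEntropy L ≤
      Real.negMulLog a + Real.negMulLog b + Real.negMulLog c + Real.negMulLog d := by
  have h1 : Real.binEntropy L ≤ Real.binEntropy a :=
    Real.binEntropy_strictAntiOn.antitoneOn ⟨ha, haL.trans hL⟩ ⟨ha.trans haL, hL⟩ haL
  rw [Real.binEntropy_eq_negMulLog_add_negMulLog_one_sub a] at h1
  have h2 := nml_subadd hb hc
  have h3 := nml_subadd (add_nonneg hb hc) hd
  rw [show b + c + d = 1 - a by linarith] at h3
  linarith

lemma nml_ge {x : ℝ} (hx : 0 ≤ x) (hx2 : x ≤ 2⁻¹) : x * Real.log 2 ≤ Real.negMulLog x := by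
  rcases hx.eq_or_lt with rfl | hx'
  · simp
  have := Real.log_le_log hx' hx2
  rw [Real.log_inv] at this
  unfold Real.negMulLog
  nlinarith

lemma ent_bound {L a b c d : ℝ} (ha : 0 ≤ a) (hb : 0 ≤ b) (hc : 0 ≤ c) (hd : 0 ≤ d)
    (hs : a + b + c + d = 1) (haL : a ≤ L) (hbL : b ≤ L) (hcL : c ≤ L) (hdL : d ≤ L)
    (hL : L ≤ 1) :
    Real.binEntropy L ≤
      Real.negMulLog a + Real.negMulLog b + Real.negMulLog c + Real.negMulLog d := by
  by_cases h1 : 2⁻¹ ≤ a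
  · exact ent_aux hb hc hd hs h1 haL hL
  by_cases h2 : 2⁻¹ ≤ b
  · have := ent_aux (a := b) ha hc hd (by linarith) h2 hbL hL
    linarith
  by_cases h3 : 2⁻¹ ≤ c
  · have := ent_aux (a := c) ha hb hd (by linarith) h3 hcL hL
    linarith
  by_cases h4 : 2⁻¹ ≤ d
  · have := ent_aux (a := d) ha hb hc (by linarith) h4 hdL hL
    linarith
  push Not at h1 h2 h3 h4
  have e : Real.log 2 = a * Real.log 2 + b * Real.log 2 + c * Real.log 2 + d * Real.log 2 := by
    rw [← add_mul, ← add_mul, ← add_mul, hs, one_mul]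
  have := Real.binEntropy_le_log_two (p := L)
  have := nml_ge ha h1.le
  have := nml_ge hb h2.le
  have := nml_ge hc h3.le
  have := nml_ge hd h4.le
  linarith

lemma num_bound {L x x' y y' : ℝ} {α β z w : ℂ} (hx : 0 ≤ x) (hx' : 0 ≤ x') (hy : 0 ≤ y)
    (hy' : 0 ≤ y') (hsx : x + x' = 1) (hsy : y + y' = 1)
    (hz : Complex.normSq z ≤ x * x') (hw : Complex.normSq w ≤ y * y')
    (hα : Complex.normSq α ≤ L) (hβ : Complex.normSq β ≤ L) :
    Complex.normSq α * (x * y) + Complex.normSq β * (x' * y')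
      + 2 * (α * β * z * w).re ≤ L := by
  have hL : 0 ≤ L := (Complex.normSq_nonneg _).trans hα
  have h1 : (α * β * z * w).re ^ 2 ≤ (L * L) * ((x * x') * (y * y')) := by
    calc (α * β * z * w).re ^ 2 ≤ Complex.normSq (α * β * z * w) := by
          rw [Complex.normSq_apply]; nlinarith [mul_self_nonneg (α * β * z * w).im]
      _ = (Complex.normSq α * Complex.normSq β) * (Complex.normSq z * Complex.normSq w) := by
          simp only [map_mul]; ring
      _ ≤ _ := by
          have := Complex.normSq_nonneg
          gcongr <;> apply_rules [mul_nonneg]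
  have h2 : 2 * (α * β * z * w).re ≤ L * (x * y' + x' * y) := by
    refine le_of_abs_le (abs_le_of_sq_le_sq ?_ ?_)
    · nlinarith [sq_nonneg (L * (x * y' - x' * y))]
    · positivity
  have h3 : Complex.normSq α * (x * y) ≤ L * (x * y) := by gcongr
  have h4 : Complex.normSq β * (x' * y') ≤ L * (x' * y') := by gcongr
  have : L * (x * y) + L * (x' * y') + L * (x * y' + x' * y) = L := by
    have : L * (x * y) + L * (x' * y') + L * (x * y' + x' * y) = L * ((x + x') * (y + y')) := by
      ring
    rw [this, hsx, hsy]; ring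
  linarith

lemma state2 {σ : Matrix (Fin 2) (Fin 2) ℂ} (h : IsState σ) :
    ∃ (x x' : ℝ) (z : ℂ), 0 ≤ x ∧ 0 ≤ x' ∧ x + x' = 1 ∧ Complex.normSq z ≤ x * x' ∧
      σ = !![(x : ℂ), z; star z, (x' : ℂ)] := by
  obtain ⟨hp, ht⟩ := h
  have h0 := hp.diag_nonneg (i := 0)
  have h1 := hp.diag_nonneg (i := 1)
  have hd := hp.det_nonneg
  have h10 : star (σ 0 1) = σ 1 0 := hp.1.apply 1 0
  rw [Complex.nonneg_iff] at h0 h1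
  have e0 : ((σ 0 0).re : ℂ) = σ 0 0 := Complex.ext rfl (by simpa using h0.2)
  have e1 : ((σ 1 1).re : ℂ) = σ 1 1 := Complex.ext rfl (by simpa using h1.2)
  refine ⟨(σ 0 0).re, (σ 1 1).re, σ 0 1, h0.1, h1.1, ?_, ?_, ?_⟩
  · have := congrArg Complex.re ht
    simpa [Matrix.trace_fin_two] using this
  · rw [Matrix.det_fin_two, ← e0, ← e1, ← h10] at hd
    have := (Complex.nonneg_iff.1 hd).1
    simp [Complex.normSq_apply] at this ⊢
    linarith
  · rw [h10, e0, e1]; exact Matrix.eta_fin_two σ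

/-- the four standard vectors -/
def bv (s c : ℂ) : Fin (2^2) → (Fin 2 × Fin 2 → ℂ) :=
  fun i => (![fun q => !![s, 0; 0, c] q.1 q.2, fun q => !![star c, 0; 0, -star s] q.1 q.2,
    fun q => !![0, s; c, 0] q.1 q.2, fun q => !![0, star c; -star s, 0] q.1 q.2] :
      Fin 4 → (Fin 2 × Fin 2 → ℂ)) i

lemma forall4 {p : Fin (2^2) → Prop} (h0 : p (0 : Fin 4)) (h1 : p (1 : Fin 4))
    (h2 : p (2 : Fin 4)) (h3 : p (3 : Fin 4)) : ∀ i, p i := by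
  intro i
  change Fin 4 at i
  fin_cases i
  exacts [h0, h1, h2, h3]

lemma sum4 {M : Type*} [AddCommMonoid M] (f : Fin (2^2) → M) :
    ∑ i, f i = f (0 : Fin 4) + f (1 : Fin 4) + f (2 : Fin 4) + f (3 : Fin 4) :=
  Fin.sum_univ_four (f : Fin 4 → M)

lemma bv_orth {s c : ℂ} (h : s * star s + c * star c = 1) (i j : Fin (2^2)) :
    star (bv s c i) ⬝ᵥ bv s c j = if i = j then 1 else 0 := by
  revert j
  revert i
  apply forall4 <;> apply forall4 <;>
    simp [bv, dotProduct, Fintype.sum_prod_type, Fin.sum_univ_two] <;>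
    simp at h <;> first | (linear_combination h) | ring

lemma bv_sum {s c : ℂ} (h : s * star s + c * star c = 1) :
    ∑ i, projVec (bv s c i) = 1 := by
  rw [sum4]
  ext ⟨a, b⟩ ⟨a', b'⟩
  simp at h
  fin_cases a <;> fin_cases b <;> fin_cases a' <;> fin_cases b' <;>
    simp [bv, projVec, vecMulVec_apply] <;> first | (linear_combination h) | ring

lemma bv_trace {s c : ℂ} {L : ℝ} (hs : Complex.normSq s ≤ L) (hc : Complex.normSq c ≤ L)
    {σ τ : Matrix (Fin 2) (Fin 2) ℂ} (hσ : IsState σ) (hτ : IsState τ) (i : Fin (2^2)) :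
    (((σ ⊗ₖ τ) * projVec (bv s c i)).trace).re ≤ L := by
  obtain ⟨x, x', z, hx, hx', hsx, hz, rfl⟩ := state2 hσ
  obtain ⟨y, y', w, hy, hy', hsy, hw, rfl⟩ := state2 hτ
  have hz' : Complex.normSq (star z) ≤ x * x' := by simpa using hz
  have hw' : Complex.normSq (star w) ≤ y * y' := by simpa using hw
  have hs' : Complex.normSq (star s) ≤ L := by simpa using hs
  have hc' : Complex.normSq (star c) ≤ L := by simpa using hc
  have hs'' : Complex.normSq (-star s) ≤ L := by simpa using hs
  have hs3 : Complex.normSq (-s) ≤ L := by simpa using hs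
  revert i
  apply forall4
  · refine le_of_eq_of_le ?_ (num_bound hx hx' hy hy' hsx hsy hz hw hs' hc)
    simp [bv, projVec, trace, Matrix.mul_apply, Fintype.sum_prod_type, Fin.sum_univ_two,
      vecMulVec_apply, Complex.normSq_apply]
    ring
  · refine le_of_eq_of_le ?_ (num_bound hx hx' hy hy' hsx hsy hz hw hc hs'')
    simp [bv, projVec, trace, Matrix.mul_apply, Fintype.sum_prod_type, Fin.sum_univ_two,
      vecMulVec_apply, Complex.normSq_apply]
    ring
  · refine le_of_eq_of_le ?_ (num_bound hx hx' hy' hy hsx (by linarith) hz (w := star w) (by linarith) hs' hc)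
    simp [bv, projVec, trace, Matrix.mul_apply, Fintype.sum_prod_type, Fin.sum_univ_two,
      vecMulVec_apply, Complex.normSq_apply]
    ring
  · refine le_of_eq_of_le ?_ (num_bound hx hx' hy' hy hsx (by linarith) hz (w := star w) (by linarith) hc hs'')
    simp [bv, projVec, trace, Matrix.mul_apply, Fintype.sum_prod_type, Fin.sum_univ_two,
      vecMulVec_apply, Complex.normSq_apply]
    ring

lemma svd_aux (M : Matrix (Fin 2) (Fin 2) ℂ) (l : Fin 2 → ℝ) (hl : l 0 + l 1 = 1)
    (hM : M * Mᴴ = diagonal (fun i => (l i : ℂ))) :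
    ∃ (V : Matrix (Fin 2) (Fin 2) ℂ) (s c : ℂ), Vᴴ * V = 1 ∧ M = !![s, 0; 0, c] * V ∧
      Complex.normSq s = l 0 ∧ Complex.normSq c = l 1 := by
  have h00 := congrFun₂ hM 0 0
  have h11 := congrFun₂ hM 1 1
  have h10 := congrFun₂ hM 1 0
  have h01 := congrFun₂ hM 0 1
  simp [Matrix.mul_apply, Fin.sum_univ_two] at h00 h11 h10 h01
  have hl0 : Complex.normSq (M 0 0) + Complex.normSq (M 0 1) = l 0 := by
    have := congrArg Complex.re h00
    simpa [Complex.normSq_apply] using this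
  have hl1 : Complex.normSq (M 1 0) + Complex.normSq (M 1 1) = l 1 := by
    have := congrArg Complex.re h11
    simpa [Complex.normSq_apply] using this
  have hl0n : 0 ≤ l 0 := by
    rw [← hl0]; exact add_nonneg (Complex.normSq_nonneg _) (Complex.normSq_nonneg _)
  rcases hl0n.eq_or_lt with h | h
  · have e1 : M 0 0 = 0 := by
      apply Complex.normSq_eq_zero.1
      linarith [Complex.normSq_nonneg (M 0 0), Complex.normSq_nonneg (M 0 1)]
    have e2 : M 0 1 = 0 := by
      apply Complex.normSq_eq_zero.1
      linarith [Complex.normSq_nonneg (M 0 0), Complex.normSq_nonneg (M 0 1)]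
    have e3 : (l 1 : ℂ) = 1 := by
      rw [← h, zero_add] at hl; rw [hl]; simp
    rw [e3] at h11
    refine ⟨!![-star (M 1 1), star (M 1 0); M 1 0, M 1 1], 0, 1, ?_, ?_, ?_, ?_⟩
    · ext i j
      fin_cases i <;> fin_cases j <;> simp [Matrix.mul_apply, Fin.sum_univ_two] <;>
        first | (linear_combination h11) | ring
    · ext i j
      fin_cases i <;> fin_cases j <;> simp [Matrix.mul_apply, Fin.sum_univ_two, e1, e2]
    · simpa using h
    · simp; linarith
  · set r : ℂ := ((Real.sqrt (l 0) : ℝ) : ℂ) with hr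
    have hrr : r * r = l 0 := by
      rw [hr, ← Complex.ofReal_mul, Real.mul_self_sqrt hl0n]
    have hr0 : r ≠ 0 := by
      rw [hr]; exact_mod_cast (Real.sqrt_pos.2 h).ne'
    have hrs : (starRingEnd ℂ) r = r := Complex.conj_ofReal _
    have hnr : Complex.normSq r = l 0 := by
      rw [hr, Complex.normSq_ofReal, Real.mul_self_sqrt hl0n]
    rw [← hrr] at h00
    have hMV : M = !![r, 0; 0, (M 0 0 * M 1 1 - M 0 1 * M 1 0) / r] *
        !![M 0 0 / r, M 0 1 / r; -star (M 0 1) / r, star (M 0 0) / r] := by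
      ext i j
      fin_cases i <;> fin_cases j <;> simp [Matrix.mul_apply, Fin.sum_univ_two] <;> field_simp
      · linear_combination (-(M 1 0)) * h00 + (M 0 0) * h10
      · linear_combination (-(M 1 1)) * h00 + (M 0 1) * h10
    refine ⟨!![M 0 0 / r, M 0 1 / r; -star (M 0 1) / r, star (M 0 0) / r], r,
      (M 0 0 * M 1 1 - M 0 1 * M 1 0) / r, ?_, hMV, hnr, ?_⟩
    · ext i j
      fin_cases i <;> fin_cases j <;> simp [Matrix.mul_apply, Fin.sum_univ_two, hrs] <;>
        field_simp <;> first | (linear_combination h00) | ring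
    · rw [Complex.normSq_div, hnr, div_eq_iff h.ne']
      have : ((Complex.normSq (M 0 0 * M 1 1 - M 0 1 * M 1 0) : ℝ) : ℂ) = ((l 1 * l 0 : ℝ) : ℂ) := by
        rw [Complex.normSq_eq_conj_mul_self]
        push_cast
        rw [← h11, ← hrr, ← h00]
        simp only [map_sub, map_mul]
        linear_combination (-(M 0 0 * starRingEnd ℂ (M 1 0) + M 0 1 * starRingEnd ℂ (M 1 1))) * h10
      exact_mod_cast this

lemma projVec_conj {n : Type*} [Fintype n] (W : Matrix n n ℂ) (v : n → ℂ) :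
    projVec (W *ᵥ v) = W * projVec v * Wᴴ := by
  unfold projVec
  rw [mul_vecMulVec, vecMulVec_mul, star_mulVec]

lemma projVec_mul {n : Type*} [Fintype n] (v w : n → ℂ) :
    projVec v * projVec w = (star v ⬝ᵥ w) • vecMulVec v (star w) := by
  unfold projVec
  rw [vecMulVec_mul_vecMulVec, vecMulVec_smul]

lemma projVec_trace {n : Type*} [Fintype n] (v : n → ℂ) :
    (projVec v).trace = star v ⬝ᵥ v := by
  unfold projVec
  rw [trace_vecMulVec, dotProduct_comm]

lemma projVec_rankOne {n : Type*} [Fintype n] [DecidableEq n] (v : n → ℂ)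
    (h : star v ⬝ᵥ v = 1) : IsRankOneProj (projVec v) := by
  refine ⟨?_, ?_, ?_⟩
  · unfold projVec Matrix.IsHermitian
    rw [conjTranspose_vecMulVec, star_star]
  · rw [projVec_mul, h, one_smul]; rfl
  · have h1 : (projVec v).rank ≤ 1 := rank_vecMulVec_le _ _
    have h2 : (projVec v).rank ≠ 0 := by
      intro hr
      unfold Matrix.rank at hr
      rw [Submodule.finrank_eq_zero, LinearMap.range_eq_bot] at hr
      have h0 : projVec v = 0 := by
        ext i j
        have := congrFun (LinearMap.congr_fun hr (Pi.single j 1)) i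
        simpa using this
      have := projVec_trace v
      rw [h0, h, trace_zero] at this
      exact zero_ne_one this
    omega

lemma meas_of_orth {d : ℕ} (v : Fin (d^2) → (Fin d × Fin d → ℂ))
    (ho : ∀ i j, star (v i) ⬝ᵥ v j = if i = j then 1 else 0)
    (hs : ∑ i, projVec (v i) = 1) : IsMeasurement (fun i => projVec (v i)) := by
  refine ⟨fun i => projVec_rankOne _ (by simp [ho]), fun i j hij => ?_, hs⟩
  rw [projVec_mul, ho, if_neg hij, zero_smul]

lemma prob_nonneg {n : Type*} [Fintype n] [DecidableEq n] {ρ P : Matrix n n ℂ}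
    (hρ : ρ.PosSemidef) (hP : IsRankOneProj P) : 0 ≤ (ρ * P).trace.re := by
  have h : (ρ * P).trace = (P * ρ * Pᴴ).trace := by
    rw [hP.1.eq, trace_mul_comm (P * ρ), ← mul_assoc, hP.2.1, trace_mul_comm]
  rw [h]
  exact (Complex.nonneg_iff.1 (hρ.mul_mul_conjTranspose_same P).trace_nonneg).1

lemma prob_sum {d : ℕ} {ρ : Matrix (Fin d × Fin d) (Fin d × Fin d) ℂ}
    {P : Fin (d^2) → Matrix (Fin d × Fin d) (Fin d × Fin d) ℂ}
    (hρ : IsState ρ) (hP : IsMeasurement P) : ∑ i, (ρ * P i).trace.re = 1 := by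
  rw [← Complex.re_sum, ← trace_sum, ← Finset.mul_sum, hP.2.2, mul_one, hρ.2, Complex.one_re]

lemma klein_nonneg {d : ℕ} {ρ : Matrix (Fin d × Fin d) (Fin d × Fin d) ℂ}
    {P : Fin (d^2) → Matrix (Fin d × Fin d) (Fin d × Fin d) ℂ}
    (hρ : IsState ρ) (hP : IsMeasurement P) : 0 ≤ kleinEntropy ρ P := by
  unfold kleinEntropy shannon
  refine Finset.sum_nonneg fun i _ => ?_
  rw [negMulLog2_eq]
  refine div_nonneg (Real.negMulLog_nonneg (prob_nonneg hρ.1 (hP.1 i)) ?_)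
    (Real.log_nonneg (by norm_num))
  rw [← prob_sum hρ hP]
  exact Finset.single_le_sum (f := fun i => (ρ * P i).trace.re)
    (fun j _ => prob_nonneg hρ.1 (hP.1 j)) (Finset.mem_univ i)

lemma klein_le {d : ℕ} {ρ : Matrix (Fin d × Fin d) (Fin d × Fin d) ℂ}
    {P : Fin (d^2) → Matrix (Fin d × Fin d) (Fin d × Fin d) ℂ}
    (hρ : IsState ρ) (hP : IsMeasurement P) :
    kleinEntropy ρ P ≤ ∑ _i : Fin (d^2), 1 / Real.log 2 := by
  unfold kleinEntropy shannon
  refine Finset.sum_le_sum fun i _ => ?_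
  rw [negMulLog2_eq]
  have h := prob_nonneg hρ.1 (hP.1 i)
  have := Real.negMulLog_le_one_sub_self h
  have := Real.log_nonneg (by norm_num : (1:ℝ) ≤ 2)
  gcongr
  linarith

lemma prod_state {d : ℕ} {δ : Matrix (Fin d × Fin d) (Fin d × Fin d) ℂ}
    (h : IsProductState δ) : IsState δ := by
  obtain ⟨σ, τ, hσ, hτ, rfl⟩ := h
  exact ⟨hσ.1.kronecker hτ.1, by rw [trace_kronecker, hσ.2, hτ.2, one_mul]⟩

lemma state_conj {U σ : Matrix (Fin 2) (Fin 2) ℂ} (hU : U * Uᴴ = 1) (hσ : IsState σ) :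
    IsState (Uᴴ * σ * U) := by
  refine ⟨hσ.1.conjTranspose_mul_mul_same U, ?_⟩
  rw [trace_mul_comm, ← mul_assoc, hU, one_mul, hσ.2]

lemma exists_prod : ∃ δ : Matrix (Fin 2 × Fin 2) (Fin 2 × Fin 2) ℂ, IsProductState δ := by
  have : IsState (projVec (Pi.single 0 1 : Fin 2 → ℂ)) :=
    ⟨posSemidef_vecMulVec_self_star _, by rw [projVec_trace]; simp [dotProduct]⟩
  exact ⟨_, _, _, this, this, rfl⟩

lemma decomp (φ : Fin 2 × Fin 2 → ℂ) (hφ : IsUnitVec φ) :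
    ∃ (U V : Matrix (Fin 2) (Fin 2) ℂ) (s c : ℂ), Uᴴ * U = 1 ∧ Vᴴ * V = 1 ∧
      schmidtSq φ 0 + schmidtSq φ 1 = 1 ∧
      Complex.normSq s = schmidtSq φ 0 ∧ Complex.normSq c = schmidtSq φ 1 ∧
      coeffMat φ = U * (!![s, 0; 0, c] * V) := by
  have hH := Matrix.isHermitian_mul_conjTranspose_self (coeffMat φ)
  have hsum : schmidtSq φ 0 + schmidtSq φ 1 = 1 := by
    have h := hH.trace_eq_sum_eigenvalues
    rw [Fin.sum_univ_two] at h
    have h' := congrArg Complex.re h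
    unfold IsUnitVec at hφ
    simp [Fintype.sum_prod_type, Fin.sum_univ_two, Complex.normSq_apply] at hφ
    simp [Matrix.trace_fin_two, Matrix.mul_apply, Fin.sum_univ_two, coeffMat] at h'
    unfold schmidtSq
    change hH.eigenvalues 0 + hH.eigenvalues 1 = 1
    simp only [coeffMat]
    linarith
  have hsp := hH.conjStarAlgAut_star_eigenvectorUnitary
  rw [Unitary.conjStarAlgAut_star_apply] at hsp
  set U : Matrix (Fin 2) (Fin 2) ℂ := (hH.eigenvectorUnitary : Matrix (Fin 2) (Fin 2) ℂ) with hU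
  have hU1 : Uᴴ * U = 1 := Unitary.coe_star_mul_self hH.eigenvectorUnitary
  have hU2 : U * Uᴴ = 1 := Unitary.coe_mul_star_self hH.eigenvectorUnitary
  obtain ⟨V, s, c, hV, hM, h0, h1⟩ := svd_aux (Uᴴ * coeffMat φ) (schmidtSq φ) hsum (by
    rw [conjTranspose_mul, conjTranspose_conjTranspose]
    rw [← star_eq_conjTranspose U]
    simp only [mul_assoc] at hsp ⊢
    exact hsp)
  refine ⟨U, V, s, c, hU1, hV, hsum, h0, h1, ?_⟩
  rw [← hM, ← mul_assoc, hU2, one_mul]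

/-- For every unit vector φ ∈ C² ⊗ C², M(|φ⟩⟨φ|) ≥ S_R(φ), the von Neumann
entropy of the reduced density matrix A Aᴴ (Shannon entropy of its eigenvalues,
i.e. of the squared Schmidt coefficients of φ). -/
theorem stmt14 (φ : Fin 2 × Fin 2 → ℂ) (hφ : IsUnitVec φ) :
    shannon (schmidtSq φ) ≤ eep (projVec φ) := by
  obtain ⟨U, V, s, c, hU, hV, hsum, hs, hc, hφe⟩ := decomp φ hφ
  have hsc : s * star s + c * star c = 1 := by
    have e1 : s * star s = (Complex.normSq s : ℂ) := Complex.mul_conj s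
    have e2 : c * star c = (Complex.normSq c : ℂ) := Complex.mul_conj c
    rw [e1, e2, hs, hc]; exact_mod_cast hsum
  have hVV : V * Vᴴ = 1 := mul_eq_one_comm.1 hV
  have hUU : U * Uᴴ = 1 := mul_eq_one_comm.1 hU
  have hVt : Vᵀ * (Vᵀ)ᴴ = 1 := by
    have e : (Vᵀ)ᴴ = (Vᴴ)ᵀ := rfl
    rw [e, ← transpose_mul, hV, transpose_one]
  set W : Matrix (Fin 2 × Fin 2) (Fin 2 × Fin 2) ℂ := U ⊗ₖ Vᵀ with hW
  have hWW : W * Wᴴ = 1 := by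
    rw [hW, conjTranspose_kronecker, ← mul_kronecker_mul, hUU, hVt, one_kronecker_one]
  have hWW' : Wᴴ * W = 1 := mul_eq_one_comm.1 hWW
  have hφW : φ = W *ᵥ bv s c (0 : Fin 4) := by
    ext ⟨i, j⟩
    have := congrFun₂ hφe i j
    simp [coeffMat, Matrix.mul_apply, Fin.sum_univ_two] at this
    rw [this]
    simp [hW, mulVec, vecMul, dotProduct, Fintype.sum_prod_type, Fin.sum_univ_two, bv]
    ring
  have ho : ∀ i j, star (W *ᵥ bv s c i) ⬝ᵥ (W *ᵥ bv s c j) = if i = j then 1 else 0 := by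
    intro i j
    rw [star_mulVec, ← dotProduct_mulVec, mulVec_mulVec, hWW', one_mulVec, bv_orth hsc]
  have hP : IsMeasurement (fun i => projVec (W *ᵥ bv s c i)) := by
    apply meas_of_orth _ ho
    simp only [projVec_conj]
    rw [← Finset.sum_mul, ← Finset.mul_sum, bv_sum hsc, mul_one, hWW]
  have hφu : star φ ⬝ᵥ φ = 1 := by
    rw [hφW, ho, if_pos rfl]
  have hφs : IsState (projVec φ) :=
    ⟨posSemidef_vecMulVec_self_star _, by rw [projVec_trace, hφu]⟩
  have hk0 : kleinEntropy (projVec φ) (fun i => projVec (W *ᵥ bv s c i)) = 0 := by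
    unfold kleinEntropy shannon
    refine Finset.sum_eq_zero fun i _ => ?_
    beta_reduce
    rw [projVec_mul]
    nth_rw 1 [hφW]
    rw [ho]
    split_ifs with h
    · subst h
      rw [← hφW, one_smul]
      change negMulLog2 (projVec φ).trace.re = 0
      rw [projVec_trace, hφu]
      simp [negMulLog2]
    · simp [negMulLog2]
  have hlog : 0 < Real.log 2 := Real.log_pos (by norm_num)
  have hinf : shannon (schmidtSq φ) ≤ infProd (fun i => projVec (W *ᵥ bv s c i)) := by
    unfold infProd
    apply le_csInf
    · obtain ⟨δ, hδ⟩ := exists_prod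
      exact ⟨_, δ, hδ, rfl⟩
    rintro _ ⟨δ, hδ, rfl⟩
    have hn : ∀ i, 0 ≤ (δ * projVec (W *ᵥ bv s c i)).trace.re :=
      fun i => prob_nonneg (prod_state hδ).1 (hP.1 i)
    have hsm := prob_sum (prod_state hδ) hP
    have hle : ∀ i, (δ * projVec (W *ᵥ bv s c i)).trace.re
        ≤ max (schmidtSq φ 0) (schmidtSq φ 1) := by
      intro i
      obtain ⟨σ, τ, hσ, hτ, rfl⟩ := hδ
      have e : ((σ ⊗ₖ τ) * projVec (W *ᵥ bv s c i)).trace =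
          (((Uᴴ * σ * U) ⊗ₖ ((Vᵀ)ᴴ * τ * Vᵀ)) * projVec (bv s c i)).trace := by
        rw [projVec_conj, mul_kronecker_mul, mul_kronecker_mul, ← conjTranspose_kronecker, ← hW,
          ← mul_assoc, trace_mul_comm]
        simp only [mul_assoc]
      rw [e]
      exact bv_trace (by rw [hs]; exact le_max_left _ _) (by rw [hc]; exact le_max_right _ _)
        (state_conj hUU hσ) (state_conj hVt hτ) i
    have h0 : 0 ≤ schmidtSq φ 0 := hs ▸ Complex.normSq_nonneg s
    have h1 : 0 ≤ schmidtSq φ 1 := hc ▸ Complex.normSq_nonneg c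
    rw [sum4] at hsm
    have key := ent_bound (hn _) (hn _) (hn _) (hn _) hsm (hle _) (hle _) (hle _) (hle _)
      (max_le (by linarith) (by linarith))
    have hbin : Real.binEntropy (max (schmidtSq φ 0) (schmidtSq φ 1)) =
        Real.negMulLog (schmidtSq φ 0) + Real.negMulLog (schmidtSq φ 1) := by
      have e1 : schmidtSq φ 1 = 1 - schmidtSq φ 0 := by linarith
      rw [e1, ← Real.binEntropy_eq_negMulLog_add_negMulLog_one_sub]
      rcases max_choice (schmidtSq φ 0) (1 - schmidtSq φ 0) with h | h <;> rw [h]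
      exact Real.binEntropy_one_sub _
    rw [hbin] at key
    unfold kleinEntropy shannon
    rw [sum4, Fin.sum_univ_two]
    simp only [negMulLog2_eq, ← add_div]
    gcongr
  have hbdd : BddAbove {x : ℝ | ∃ P, IsMeasurement P ∧
      x = infProd P - kleinEntropy (projVec φ) P} := by
    refine ⟨∑ _i : Fin (2^2), 1 / Real.log 2, ?_⟩
    rintro _ ⟨P, hP, rfl⟩
    obtain ⟨δ, hδ⟩ := exists_prod
    have h1 : infProd P ≤ kleinEntropy δ P := by
      refine csInf_le ⟨0, ?_⟩ ⟨δ, hδ, rfl⟩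
      rintro _ ⟨δ', hδ', rfl⟩
      exact klein_nonneg (prod_state hδ') hP
    have h2 := klein_le (prod_state hδ) hP
    have h3 := klein_nonneg hφs hP
    linarith
  refine hinf.trans (le_csSup hbdd ⟨_, hP, ?_⟩)
  rw [hk0, sub_zero]

end EEP
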